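/- arXiv:1706.01431 — 2 statements merged into one kernel-verified Lean document; each statement's English description precedes it below -/
import Mathlib

section
/- Let G be a finite group with 1 ∈ CD(G). If H, K ∈ CD(G) satisfy H ∩ K = 1 and G = HK, then G is the internal direct product of H and K; in particular both H and K are normal in G and every element of H commutes with every element of K. -/
open Pointwise

/-- The Chermak-Delgado measure of a subgroup: `m_G(H) = |H| * |C_G(H)|`. -/
noncomputable def cdMeasure {G : Type*} [Group G] (H : Subgroup G) : Nat :=
  Nat.card H * Nat.card (Subgroup.centralizer (H : Set G))

/-- The Chermak-Delgado lattice of `G`: the subgroups of maximal Chermak-Delgado measure. -/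
def CD (G : Type*) [Group G] : Set (Subgroup G) :=
  {H | ∀ K : Subgroup G, cdMeasure K ≤ cdMeasure H}

open Subgroup

/-- The product formula `|X| |Y| = |XY| |X ∩ Y|`. -/
theorem card_mul_card_eq_card_mul_mul_card_inf {G : Type*} [Group G] (X Y : Subgroup G) :
    Nat.card X * Nat.card Y =
      Nat.card ((X : Set G) * (Y : Set G) : Set G) * Nat.card (X ⊓ Y : Subgroup G) := by
  have hrep : ∀ p : ((X : Set G) * (Y : Set G) : Set G), ∃ a ∈ X, ∃ b ∈ Y, a * b = p :=
    fun p => Set.mem_mul.1 p.2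
  choose a ha b hb hab using hrep
  rw [← Nat.card_prod, ← Nat.card_prod]
  refine (Nat.card_congr (Equiv.ofBijective
    (fun q : ((X : Set G) * (Y : Set G) : Set G) × (X ⊓ Y : Subgroup G) =>
      ((⟨a q.1 * q.2, X.mul_mem (ha _) q.2.2.1⟩ : X),
        (⟨(q.2 : G)⁻¹ * b q.1, Y.mul_mem (Y.inv_mem q.2.2.2) (hb _)⟩ : Y))) ⟨?_, ?_⟩)).symm
  · rintro ⟨p, z⟩ ⟨p', z'⟩ h
    simp only [Prod.mk.injEq, Subtype.mk.injEq] at h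
    obtain ⟨h₁, h₂⟩ := h
    have hp : p = p' := by
      apply Subtype.ext
      rw [← hab p, ← hab p']
      calc a p * b p = (a p * z) * ((z : G)⁻¹ * b p) := by group
        _ = (a p' * z') * ((z' : G)⁻¹ * b p') := by rw [h₁, h₂]
        _ = a p' * b p' := by group
    subst hp
    rw [Subtype.ext (mul_left_cancel h₁)]
  · rintro ⟨⟨x, hx⟩, ⟨y, hy⟩⟩
    let p : ((X : Set G) * (Y : Set G) : Set G) := ⟨x * y, Set.mul_mem_mul hx hy⟩
    have hp : a p * b p = x * y := hab p
    have hz : (a p)⁻¹ * x = b p * y⁻¹ := by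
      rw [inv_mul_eq_iff_eq_mul, ← mul_assoc, hp, mul_inv_cancel_right]
    refine ⟨(p, ⟨(a p)⁻¹ * x, X.mul_mem (X.inv_mem (ha p)) hx, ?_⟩), ?_⟩
    · change (a p)⁻¹ * x ∈ Y
      exact hz ▸ Y.mul_mem (hb p) (Y.inv_mem hy)
    · refine Prod.ext (Subtype.ext ?_) (Subtype.ext ?_)
      · exact mul_inv_cancel_left _ _
      · change ((a p)⁻¹ * x)⁻¹ * b p = y
        rw [hz]
        group

theorem centralizer_sup_eq_inf {G : Type*} [Group G] (X Y : Subgroup G) :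
    centralizer ((X ⊔ Y : Subgroup G) : Set G) =
      centralizer (X : Set G) ⊓ centralizer (Y : Set G) := by
  refine le_antisymm (le_inf (centralizer_le (SetLike.coe_subset_coe.2 le_sup_left))
    (centralizer_le (SetLike.coe_subset_coe.2 le_sup_right))) ?_
  rw [← le_centralizer_iff]
  exact sup_le (le_centralizer_iff.1 inf_le_left) (le_centralizer_iff.1 inf_le_right)

theorem cdMeasure_eq_of_mem_CD {G : Type*} [Group G] {X Y : Subgroup G} (hX : X ∈ CD G)
    (hY : Y ∈ CD G) : cdMeasure X = cdMeasure Y :=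
  le_antisymm (hY X) (hX Y)

theorem mem_CD_of_le {G : Type*} [Group G] {X Y : Subgroup G} (hX : X ∈ CD G)
    (h : cdMeasure X ≤ cdMeasure Y) : Y ∈ CD G :=
  fun K => (hX K).trans h

theorem card_mul_card_centralizer_of_bot_mem_CD {G : Type*} [Group G]
    (hbot : (⊥ : Subgroup G) ∈ CD G) {X : Subgroup G} (hX : X ∈ CD G) :
    Nat.card X * Nat.card (centralizer (X : Set G)) = Nat.card G := by
  have h : cdMeasure (⊥ : Subgroup G) = Nat.card G := by
    have hc : centralizer ((⊥ : Subgroup G) : Set G) = ⊤ :=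
      centralizer_eq_top_iff_subset.2 (show (⊥ : Subgroup G) ≤ center G from bot_le)
    rw [cdMeasure, hc, card_bot, card_top, one_mul]
  rw [← h, ← cdMeasure_eq_of_mem_CD hX hbot, cdMeasure]

section Finite

variable {G : Type*} [Group G] [Finite G]

/-- Two members of the Chermak-Delgado lattice have their join and meet in it, and permute. -/
theorem sup_inf_mem_CD {X Y : Subgroup G} (hX : X ∈ CD G) (hY : Y ∈ CD G) :
    X ⊔ Y ∈ CD G ∧ X ⊓ Y ∈ CD G ∧ ((X ⊔ Y : Subgroup G) : Set G) = (X : Set G) * (Y : Set G) := by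
  have hsub : (X : Set G) * (Y : Set G) ⊆ ((X ⊔ Y : Subgroup G) : Set G) := by
    rintro _ ⟨x, hx, y, hy, rfl⟩
    exact mul_mem (mem_sup_left hx) (mem_sup_right hy)
  have hsub' : (centralizer (X : Set G) : Set G) * (centralizer (Y : Set G) : Set G) ⊆
      (centralizer ((X ⊓ Y : Subgroup G) : Set G) : Set G) := by
    rintro _ ⟨x, hx, y, hy, rfl⟩
    exact mul_mem (centralizer_le (show ((X ⊓ Y : Subgroup G) : Set G) ⊆ X from inf_le_left) hx)
      (centralizer_le (show ((X ⊓ Y : Subgroup G) : Set G) ⊆ Y from inf_le_right) hy)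
  have hp := Nat.card_mono (Set.toFinite _) hsub
  have hq := Nat.card_mono (Set.toFinite _) hsub'
  have h₁ := card_mul_card_eq_card_mul_mul_card_inf X Y
  have h₂ := card_mul_card_eq_card_mul_mul_card_inf (centralizer (X : Set G))
    (centralizer (Y : Set G))
  have hXY := cdMeasure_eq_of_mem_CD hX hY
  have hs := hX (X ⊔ Y)
  have hi := hX (X ⊓ Y)
  have hi0 : 0 < Nat.card (X ⊓ Y : Subgroup G) := Nat.card_pos
  have hr0 : 0 < Nat.card (centralizer ((X ⊓ Y : Subgroup G) : Set G)) := Nat.card_pos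
  have hc0 : 0 < Nat.card
    (centralizer (X : Set G) ⊓ centralizer (Y : Set G) : Subgroup G) := Nat.card_pos
  have hsq : Nat.card ((X : Set G) * (Y : Set G) : Set G) * Nat.card (X ⊓ Y : Subgroup G) *
      (Nat.card ((centralizer (X : Set G) : Set G) * (centralizer (Y : Set G) : Set G) : Set G) *
      Nat.card (centralizer (X : Set G) ⊓ centralizer (Y : Set G) : Subgroup G)) =
      cdMeasure X * cdMeasure X := by
    rw [← h₁, ← h₂]
    nth_rewrite 2 [hXY]
    unfold cdMeasure
    ring
  have hm0 : 0 < cdMeasure X := Nat.mul_pos Nat.card_pos Nat.card_pos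
  have es : cdMeasure (X ⊔ Y) = Nat.card (X ⊔ Y : Subgroup G) *
      Nat.card (centralizer (X : Set G) ⊓ centralizer (Y : Set G) : Subgroup G) := by
    rw [cdMeasure, centralizer_sup_eq_inf]
  have ei : cdMeasure (X ⊓ Y) = Nat.card (X ⊓ Y : Subgroup G) *
      Nat.card (centralizer ((X ⊓ Y : Subgroup G) : Set G)) := rfl
  change _ ≤ Nat.card (X ⊔ Y : Subgroup G) at hp
  change _ ≤ Nat.card (centralizer ((X ⊓ Y : Subgroup G) : Set G)) at hq
  generalize hm : cdMeasure X = m at *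
  generalize hA : cdMeasure (X ⊔ Y) = A at *
  generalize hB : cdMeasure (X ⊓ Y) = B at *
  generalize hpn : Nat.card ((X : Set G) * (Y : Set G) : Set G) = p at *
  generalize han : Nat.card (X ⊔ Y : Subgroup G) = a at *
  generalize Nat.card (X ⊓ Y : Subgroup G) = i at *
  generalize Nat.card
    ((centralizer (X : Set G) : Set G) * (centralizer (Y : Set G) : Set G) : Set G) = q at *
  generalize Nat.card (centralizer (X : Set G) ⊓ centralizer (Y : Set G) : Subgroup G) = c at *
  generalize Nat.card (centralizer ((X ⊓ Y : Subgroup G) : Set G)) = r at *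
  have hge : m * m ≤ A * B := by
    rw [← hsq, es, ei]
    calc p * i * (q * c) ≤ a * i * (r * c) := by gcongr
      _ = _ := by ring
  have hmA : m ≤ A := Nat.le_of_mul_le_mul_right (hge.trans (Nat.mul_le_mul_left A hi)) hm0
  have hmB : m ≤ B := Nat.le_of_mul_le_mul_left (hge.trans (Nat.mul_le_mul_right B hs)) hm0
  have hap : a ≤ p := by
    refine Nat.le_of_mul_le_mul_right (c := i * r * c) ?_ (by positivity)
    calc a * (i * r * c) = A * B := by rw [es, ei]; ring
      _ ≤ m * m := Nat.mul_le_mul hs hi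
      _ = p * i * (q * c) := hsq.symm
      _ ≤ p * i * (r * c) := by gcongr
      _ = p * (i * r * c) := by ring
  refine ⟨fun K => ?_, fun K => ?_, (Set.eq_of_subset_of_ncard_le hsub ?_ (Set.toFinite _)).symm⟩
  · rw [hA]
    exact (hX K).trans (hm.le.trans hmA)
  · rw [hB]
    exact (hX K).trans (hm.le.trans hmB)
  · rw [← Nat.card_coe_set_eq, ← Nat.card_coe_set_eq, hpn]
    exact han.le.trans hap

/-- A member of the Chermak-Delgado lattice is its own double centralizer. -/
theorem centralizer_centralizer_of_mem_CD {X : Subgroup G} (hX : X ∈ CD G) :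
    centralizer (centralizer (X : Set G) : Set G) = X := by
  refine (eq_of_le_of_card_ge (le_centralizer_iff.1 le_rfl) ?_).symm
  have h := hX (centralizer (X : Set G))
  rw [cdMeasure, cdMeasure, mul_comm] at h
  exact Nat.le_of_mul_le_mul_right h Nat.card_pos

theorem centralizer_mem_CD {X : Subgroup G} (hX : X ∈ CD G) : centralizer (X : Set G) ∈ CD G := by
  refine mem_CD_of_le hX ?_
  rw [cdMeasure, cdMeasure, centralizer_centralizer_of_mem_CD hX, mul_comm]

theorem map_conj_mem_CD {X : Subgroup G} (hX : X ∈ CD G) (g : G) :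
    X.map (MulAut.conj g).toMonoidHom ∈ CD G := by
  have hinj : Function.Injective (MulAut.conj g).toMonoidHom := (MulAut.conj g).injective
  refine mem_CD_of_le hX ?_
  rw [cdMeasure, cdMeasure, card_map_of_injective hinj]
  refine Nat.mul_le_mul_left _ ?_
  rw [← card_map_of_injective (K := centralizer (X : Set G)) hinj]
  exact card_le_of_le (map_centralizer_le_centralizer_image _ _)

/-- A member of the Chermak-Delgado lattice is normalized by every member covering it. -/
theorem conj_mem_of_covBy_mem_CD {X T : Subgroup G} (hX : X ∈ CD G) (hXT : X ≤ T)
    (hcov : ∀ Y ∈ CD G, X ≤ Y → Y ≤ T → Y = X ∨ Y = T) {t : G} (ht : t ∈ T) {x : G} (hx : x ∈ X) :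
    t * x * t⁻¹ ∈ X := by
  obtain ⟨hsup, -, hmul⟩ := sup_inf_mem_CD hX (map_conj_mem_CD hX t)
  have hconj : X.map (MulAut.conj t).toMonoidHom ≤ T := by
    rintro _ ⟨y, hy, rfl⟩
    exact mul_mem (mul_mem ht (hXT hy)) (inv_mem ht)
  rcases hcov _ hsup le_sup_left (sup_le hXT hconj) with h | h
  · rw [← h]
    exact mem_sup_right ⟨x, hx, rfl⟩
  · have ht' : t⁻¹ ∈ ((X ⊔ X.map (MulAut.conj t).toMonoidHom : Subgroup G) : Set G) := by
      rw [h]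
      exact inv_mem ht
    rw [hmul] at ht'
    obtain ⟨y, hy, _, ⟨z, hz, rfl⟩, hyz⟩ := ht'
    have htyz : t = y⁻¹ * z⁻¹ := by
      have h1 : y * (t * z * t⁻¹) = t⁻¹ := hyz
      have h2 : y * (t * z) = 1 := by
        rw [← mul_assoc, mul_eq_right] at h1
        exact h1
      rw [eq_inv_mul_iff_mul_eq, eq_inv_iff_mul_eq_one, mul_assoc, h2]
    have htX : t ∈ X := htyz ▸ mul_mem (inv_mem hy) (inv_mem hz)
    exact mul_mem (mul_mem htX hx) (inv_mem htX)

theorem top_mem_CD_of_bot_mem_CD (hbot : (⊥ : Subgroup G) ∈ CD G) : (⊤ : Subgroup G) ∈ CD G := by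
  refine mem_CD_of_le hbot ?_
  rw [cdMeasure, cdMeasure,
    card_mul_card_centralizer_of_bot_mem_CD hbot hbot, card_top]
  exact Nat.le_mul_of_pos_right _ Nat.card_pos

/-- A normal subgroup `W` and a subgroup `L`, both in the Chermak-Delgado lattice and meeting
trivially, have `C_W(L) ≠ 1` unless `W = 1`. -/
theorem eq_bot_of_normal_of_inf_centralizer_eq_bot {W L : Subgroup G} (hW : W ∈ CD G)
    (hL : L ∈ CD G) (hn : W.Normal) (hWL : W ⊓ L = ⊥)
    (hc : W ⊓ centralizer (L : Set G) = ⊥) : W = ⊥ := by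
  by_contra hne
  have hlt : L < L ⊔ W := by
    refine lt_of_le_of_ne le_sup_left fun h => hne ?_
    rw [← hWL, left_eq_inf, h]
    exact le_sup_right
  obtain ⟨T, ⟨hT, hLT, hTW⟩, hmin⟩ :=
    (Set.toFinite {Y : Subgroup G | Y ∈ CD G ∧ L < Y ∧ Y ≤ L ⊔ W}).exists_minimal
      ⟨L ⊔ W, (sup_inf_mem_CD hL hW).1, hlt, le_rfl⟩
  have hcov : ∀ Y ∈ CD G, L ≤ Y → Y ≤ T → Y = L ∨ Y = T := by
    intro Y hY hLY hYT
    rcases hLY.eq_or_lt with h | h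
    · exact Or.inl h.symm
    · exact Or.inr (le_antisymm hYT (hmin ⟨hY, h, hYT.trans hTW⟩ hYT))
  obtain ⟨t, htT, htL⟩ := SetLike.exists_of_lt hLT
  obtain ⟨l, hl, w, hw, rfl⟩ : t ∈ (L : Set G) * (W : Set G) := by
    rw [← (sup_inf_mem_CD hL hW).2.2]
    exact hTW htT
  have hwT : w ∈ T := (T.mul_mem_cancel_left (hLT.le hl)).1 htT
  have hw1 : w ∈ W ⊓ centralizer (L : Set G) := by
    refine ⟨hw, mem_centralizer_iff_commutator_eq_one'.2 fun x hx => ?_⟩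
    rw [← mem_bot, ← hWL]
    refine ⟨?_, L.mul_mem (conj_mem_of_covBy_mem_CD hL hLT.le hcov hwT hx) (L.inv_mem hx)⟩
    have h := W.mul_mem hw (hn.conj_mem _ (W.inv_mem hw) x)
    simpa [commutatorElement_def, mul_assoc] using h
  rw [hc, mem_bot] at hw1
  subst hw1
  exact htL (by simpa using hl)

/-- If `1 ∈ CD(G)`, a complemented member of `CD(G)` generates `G` with its centralizer. -/
theorem sup_centralizer_eq_top {H K : Subgroup G} (hbot : (⊥ : Subgroup G) ∈ CD G)
    (hH : H ∈ CD G) (hK : K ∈ CD G) (hint : H ⊓ K = ⊥) (hsup : H ⊔ K = ⊤) :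
    H ⊔ centralizer (H : Set G) = ⊤ := by
  by_contra hne
  obtain ⟨M, ⟨hM, hHM, hMtop⟩, hmax⟩ :=
    (Set.toFinite {Y : Subgroup G | Y ∈ CD G ∧ H ⊔ centralizer (H : Set G) ≤ Y ∧
      Y ≠ ⊤}).exists_maximal ⟨_, (sup_inf_mem_CD hH (centralizer_mem_CD hH)).1, le_rfl, hne⟩
  have hcov : ∀ Y ∈ CD G, M ≤ Y → Y ≤ ⊤ → Y = M ∨ Y = ⊤ := by
    intro Y hY hMY _
    by_cases h : Y = ⊤
    · exact Or.inr h
    · exact Or.inl (le_antisymm (hmax ⟨hY, hHM.trans hMY, h⟩ hMY) hMY)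
  have hMn : M.Normal :=
    ⟨fun _ hx g => conj_mem_of_covBy_mem_CD hM le_top hcov (mem_top g) hx⟩
  have hcM : centralizer (M : Set G) ≤ centralizer (H : Set G) :=
    centralizer_le (SetLike.coe_subset_coe.2 (le_sup_left.trans hHM))
  have hcM' : centralizer (M : Set G) ≤ H := by
    rw [← centralizer_centralizer_of_mem_CD hH]
    exact centralizer_le (SetLike.coe_subset_coe.2 (le_sup_right.trans hHM))
  have hcenter : centralizer (H : Set G) ⊓ centralizer (K : Set G) = ⊥ := by
    rw [← centralizer_sup_eq_inf, hsup, ← card_eq_one]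
    have h := card_mul_card_centralizer_of_bot_mem_CD hbot (top_mem_CD_of_bot_mem_CD hbot)
    rw [card_top] at h
    exact (Nat.mul_eq_left Nat.card_pos.ne').1 h
  have hW : centralizer (M : Set G) = ⊥ := by
    refine eq_bot_of_normal_of_inf_centralizer_eq_bot (centralizer_mem_CD hM)
      (centralizer_mem_CD hK) inferInstance ?_ ?_
    · exact le_bot_iff.1 ((inf_le_inf_right _ hcM).trans hcenter.le)
    · rw [centralizer_centralizer_of_mem_CD hK]
      exact le_bot_iff.1 ((inf_le_inf_right _ hcM').trans hint.le)
  refine hMtop (card_eq_iff_eq_top M |>.1 ?_)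
  rw [← card_mul_card_centralizer_of_bot_mem_CD hbot hM, hW, card_bot, mul_one]

/-- If `1 ∈ CD(G)`, a complemented member of `CD(G)` is normal. -/
theorem normal_of_complement_mem_CD {H K : Subgroup G} (hbot : (⊥ : Subgroup G) ∈ CD G)
    (hH : H ∈ CD G) (hK : K ∈ CD G) (hint : H ⊓ K = ⊥) (hsup : H ⊔ K = ⊤) : H.Normal := by
  rw [← normalizer_eq_top_iff, ← top_le_iff, ← sup_centralizer_eq_top hbot hH hK hint hsup]
  exact sup_le le_normalizer (centralizer_le_normalizer _)

end Finite

theorem stmt8 {G : Type*} [Group G] [Fintype G] (hbot : (⊥ : Subgroup G) ∈ CD G)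
    (H K : Subgroup G) (hH : H ∈ CD G) (hK : K ∈ CD G)
    (hint : H ⊓ K = ⊥) (hprod : (H : Set G) * (K : Set G) = Set.univ) :
    H.Normal ∧ K.Normal ∧ ∀ h ∈ H, ∀ k ∈ K, Commute h k := by
  have hsup : H ⊔ K = ⊤ := by
    rw [← coe_eq_univ, (sup_inf_mem_CD hH hK).2.2, hprod]
  have hHn := normal_of_complement_mem_CD hbot hH hK hint hsup
  have hKn := normal_of_complement_mem_CD hbot hK hH (inf_comm H K ▸ hint) (sup_comm H K ▸ hsup)
  exact ⟨hHn, hKn, fun h hh k hk =>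
    commute_of_normal_of_disjoint H K hHn hKn (disjoint_iff.2 hint) h k hh hk⟩
end

section
/- Let G be a finite group with 1 ∈ CD(G), and suppose CD(G) (ordered by inclusion) is order-isomorphic to a Cartesian product L₁ × L₂ of lattices L₁ and L₂ (with the componentwise order). Then G is the internal direct product of subgroups H and K such that CD(H) is order-isomorphic to L₁ and CD(K) is order-isomorphic to L₂. -/
open Pointwise

namespace Subgroup

variable {G : Type*} [Group G]

theorem card_mul_card_le_card_inf_mul_card_sup [Finite G] (H K : Subgroup G) :
    Nat.card H * Nat.card K ≤ Nat.card ↥(H ⊓ K) * Nat.card ↥(H ⊔ K) := by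
  have hK : Nat.card ↥(H ⊓ K) * H.relIndex K = Nat.card K := by
    rw [← inf_relIndex_right, ← relIndex_bot_left, ← relIndex_bot_left]
    exact relIndex_mul_relIndex _ _ _ bot_le inf_le_right
  have hsup : Nat.card H * H.relIndex (H ⊔ K) = Nat.card ↥(H ⊔ K) := by
    rw [← relIndex_bot_left, ← relIndex_bot_left]
    exact relIndex_mul_relIndex _ _ _ bot_le le_sup_left
  have hle : H.relIndex K ≤ H.relIndex (H ⊔ K) :=
    relIndex_le_of_le_right le_sup_right index_ne_zero_of_finite
  calc Nat.card H * Nat.card K = Nat.card ↥(H ⊓ K) * (Nat.card H * H.relIndex K) := by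
        rw [← hK]; ring
    _ ≤ Nat.card ↥(H ⊓ K) * (Nat.card H * H.relIndex (H ⊔ K)) := by gcongr
    _ = Nat.card ↥(H ⊓ K) * Nat.card ↥(H ⊔ K) := by rw [hsup]

theorem centralizer_coe_sup (H K : Subgroup G) :
    centralizer (↑(H ⊔ K) : Set G) = centralizer (H : Set G) ⊓ centralizer (K : Set G) := by
  refine le_antisymm (le_inf (centralizer_le (le_sup_left : H ≤ H ⊔ K))
    (centralizer_le (le_sup_right : K ≤ H ⊔ K))) ?_
  rw [le_centralizer_iff]
  exact sup_le (le_centralizer_iff.1 inf_le_left) (le_centralizer_iff.1 inf_le_right)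

theorem centralizer_map_equiv {G' : Type*} [Group G'] (f : G ≃* G') (H : Subgroup G) :
    centralizer (H.map f.toMonoidHom : Set G') =
      (centralizer (H : Set G)).map f.toMonoidHom := by
  ext x
  obtain ⟨y, rfl⟩ := f.surjective x
  simp [mem_centralizer_iff, ← map_mul]

theorem card_centralizer_map_subtype {H K : Subgroup G} (hH : H.Normal) (hK : K.Normal)
    (hinf : H ⊓ K = ⊥) (hsup : H ⊔ K = ⊤) (U : Subgroup H) :
    Nat.card (centralizer (U.map H.subtype : Set G)) =
      Nat.card (centralizer (U : Set H)) * Nat.card K := by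
  have hdis : Disjoint H K := disjoint_iff.2 hinf
  have hcomm : ∀ x ∈ H, ∀ y ∈ K, x * y = y * x := fun x hx y hy =>
    commute_of_normal_of_disjoint H K hH hK hdis x y hx hy
  rw [← Nat.card_prod]
  symm
  refine Nat.card_eq_of_bijective
    (fun p : centralizer (U : Set H) × K => ⟨((p.1 : H) : G) * p.2, ?_⟩) ⟨?_, ?_⟩
  · rw [mem_centralizer_iff]
    rintro _ ⟨u, hu, rfl⟩
    have h₁ : (u : G) * (p.1 : H) = (p.1 : H) * u :=
      congrArg Subtype.val (mem_centralizer_iff.1 p.1.2 u hu)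
    have h₂ := hcomm u u.2 p.2 p.2.2
    simp only [subtype_apply]
    rw [← mul_assoc, h₁, mul_assoc, h₂, mul_assoc]
  · rintro ⟨⟨a, ha⟩, k⟩ ⟨⟨b, hb⟩, l⟩ h
    have := mul_injective_of_disjoint hdis (a₁ := (a, k)) (a₂ := (b, l)) (Subtype.ext_iff.1 h)
    simpa [Prod.ext_iff] using this
  · rintro ⟨x, hx⟩
    obtain ⟨a, ha, k, hk, rfl⟩ := (mul_normal H K).le (hsup ▸ mem_top x : x ∈ H ⊔ K)
    refine ⟨⟨⟨⟨a, ha⟩, ?_⟩, ⟨k, hk⟩⟩, rfl⟩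
    rw [mem_centralizer_iff]
    intro u hu
    have h₁ : (u : G) * (a * k) = a * k * u :=
      mem_centralizer_iff.1 hx u (mem_map_of_mem H.subtype hu)
    rw [mul_assoc, ← hcomm u u.2 k hk, ← mul_assoc, ← mul_assoc] at h₁
    exact Subtype.ext (mul_right_cancel h₁)

end Subgroup

section ChermakDelgado

variable {G : Type*} [Group G]

theorem cdMeasure_map_equiv {G' : Type*} [Group G'] (f : G ≃* G') (H : Subgroup G) :
    cdMeasure (H.map f.toMonoidHom) = cdMeasure H := by
  unfold cdMeasure
  rw [Subgroup.centralizer_map_equiv]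
  exact congrArg₂ (· * ·) (Subgroup.card_map_of_injective f.injective)
    (Subgroup.card_map_of_injective f.injective)

theorem cdMeasure_mul_cdMeasure_le [Finite G] (H K : Subgroup G) :
    cdMeasure H * cdMeasure K ≤ cdMeasure (H ⊓ K) * cdMeasure (H ⊔ K) := by
  have h₁ := Subgroup.card_mul_card_le_card_inf_mul_card_sup H K
  have h₂ := Subgroup.card_mul_card_le_card_inf_mul_card_sup
    (Subgroup.centralizer (H : Set G)) (Subgroup.centralizer (K : Set G))
  have h₃ : Nat.card ↥(Subgroup.centralizer (H : Set G) ⊔ Subgroup.centralizer (K : Set G)) ≤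
      Nat.card (Subgroup.centralizer (↑(H ⊓ K) : Set G)) :=
    Subgroup.card_le_of_le <| sup_le
      (Subgroup.centralizer_le (inf_le_left : H ⊓ K ≤ H))
      (Subgroup.centralizer_le (inf_le_right : H ⊓ K ≤ K))
  rw [← Subgroup.centralizer_coe_sup] at h₂
  replace h₂ := h₂.trans (Nat.mul_le_mul_left _ h₃)
  unfold cdMeasure
  calc _ = _ := mul_mul_mul_comm _ _ _ _
    _ ≤ _ := Nat.mul_le_mul h₁ h₂
    _ = _ := by ring

theorem cdMeasure_pos [Finite G] (H : Subgroup G) : 0 < cdMeasure H :=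
  Nat.mul_pos Nat.card_pos Nat.card_pos

theorem mem_CD_of_cdMeasure_le {H K : Subgroup G} (hH : H ∈ CD G)
    (h : cdMeasure H ≤ cdMeasure K) : K ∈ CD G :=
  fun U => (hH U).trans h

theorem inf_mem_CD [Finite G] {H K : Subgroup G} (hH : H ∈ CD G) (hK : K ∈ CD G) :
    H ⊓ K ∈ CD G := by
  refine mem_CD_of_cdMeasure_le hH (Nat.le_of_mul_le_mul_right ?_ (cdMeasure_pos K))
  exact (cdMeasure_mul_cdMeasure_le H K).trans (Nat.mul_le_mul_left _ (hK _))

theorem sup_mem_CD [Finite G] {H K : Subgroup G} (hH : H ∈ CD G) (hK : K ∈ CD G) :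
    H ⊔ K ∈ CD G := by
  refine mem_CD_of_cdMeasure_le hK (Nat.le_of_mul_le_mul_left ?_ (cdMeasure_pos H))
  exact (cdMeasure_mul_cdMeasure_le H K).trans (Nat.mul_le_mul_right _ (hH _))

theorem map_equiv_mem_CD {H : Subgroup G} (hH : H ∈ CD G) (f : G ≃* G) :
    H.map f.toMonoidHom ∈ CD G :=
  mem_CD_of_cdMeasure_le hH (cdMeasure_map_equiv f H).ge

theorem cdMeasure_bot : cdMeasure (⊥ : Subgroup G) = Nat.card G := by
  have h : Subgroup.centralizer ((⊥ : Subgroup G) : Set G) = ⊤ := by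
    simp [Subgroup.centralizer_eq_top_iff_subset]
  rw [cdMeasure, h, Subgroup.card_bot, one_mul, Subgroup.card_top]

theorem top_mem_CD [Finite G] (hbot : (⊥ : Subgroup G) ∈ CD G) : (⊤ : Subgroup G) ∈ CD G := by
  refine mem_CD_of_cdMeasure_le hbot ?_
  rw [cdMeasure_bot, cdMeasure, Subgroup.card_top]
  exact Nat.le_mul_of_pos_right _ Nat.card_pos

theorem map_subtype_mem_CD_iff [Finite G] (hbot : (⊥ : Subgroup G) ∈ CD G) {H K : Subgroup G}
    (hH : H.Normal) (hK : K.Normal) (hinf : H ⊓ K = ⊥) (hsup : H ⊔ K = ⊤) (U : Subgroup H) :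
    U.map H.subtype ∈ CD G ↔ U ∈ CD H := by
  have hm : ∀ V : Subgroup H, cdMeasure (V.map H.subtype) = cdMeasure V * Nat.card K := by
    intro V
    rw [cdMeasure, Subgroup.card_centralizer_map_subtype hH hK hinf hsup,
      Subgroup.card_map_of_injective H.subtype_injective, ← mul_assoc, cdMeasure]
  constructor
  · intro hU V
    have := hU (V.map H.subtype)
    rw [hm, hm] at this
    exact Nat.le_of_mul_le_mul_right this Nat.card_pos
  · intro hU
    refine mem_CD_of_cdMeasure_le hbot ?_
    have := Nat.mul_le_mul_right (Nat.card K) (hU ⊥)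
    rwa [← hm, ← hm, Subgroup.map_bot] at this

/-- In a product decomposition of the Chermak-Delgado lattice, the complement of a factor is
unique. -/
theorem eq_of_isCompl_factor {L₁ L₂ : Type*} [Lattice L₁] [Lattice L₂]
    (e : CD G ≃o L₁ × L₂) {bot top A B C : CD G} (hbot : bot.1 = ⊥) (htop : top.1 = ⊤)
    (hA : e A = ((e top).1, (e bot).2)) (hB : e B = ((e bot).1, (e top).2))
    (hinf : C.1 ⊓ B.1 = ⊥) (hsup : C.1 ⊔ B.1 = ⊤) : C = A := by
  have hbC : e bot ≤ e C := e.monotone (show bot.1 ≤ C.1 from hbot ▸ bot_le)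
  have hCt : e C ≤ e top := e.monotone (show C.1 ≤ top.1 from htop ▸ le_top)
  have h₁ : e.symm ((e bot).1, (e C).2) ≤ C := e.symm_apply_le.2 ⟨hbC.1, le_rfl⟩
  have h₂ : e.symm ((e bot).1, (e C).2) ≤ B :=
    e.symm_apply_le.2 (hB ▸ ⟨le_rfl, hCt.2⟩)
  have h₃ : C ≤ e.symm ((e C).1, (e top).2) := e.le_symm_apply.2 ⟨le_rfl, hCt.2⟩
  have h₄ : B ≤ e.symm ((e C).1, (e top).2) :=
    e.le_symm_apply.2 (hB ▸ ⟨hbC.1, le_rfl⟩)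
  have h₅ : e.symm ((e bot).1, (e C).2) ≤ bot :=
    show (e.symm ((e bot).1, (e C).2)).1 ≤ bot.1 by
      rw [hbot, ← hinf]
      exact le_inf h₁ h₂
  have h₆ : top ≤ e.symm ((e C).1, (e top).2) :=
    show top.1 ≤ (e.symm ((e C).1, (e top).2)).1 by
      rw [htop, ← hsup]
      exact sup_le h₃ h₄
  apply e.injective
  rw [hA]
  exact Prod.ext (le_antisymm hCt.1 (e.le_symm_apply.1 h₆).1)
    (le_antisymm (e.symm_apply_le.1 h₅).2 hbC.2)

theorem factor_inf_eq_bot [Finite G] {L₁ L₂ : Type*} [Lattice L₁] [Lattice L₂]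
    (e : CD G ≃o L₁ × L₂) {bot top A B : CD G} (hbot : bot.1 = ⊥)
    (hA : e A = ((e top).1, (e bot).2)) (hB : e B = ((e bot).1, (e top).2)) :
    A.1 ⊓ B.1 = ⊥ := by
  let M : CD G := ⟨A.1 ⊓ B.1, inf_mem_CD A.2 B.2⟩
  have h₁ : e M ≤ e A := e.monotone (inf_le_left : A.1 ⊓ B.1 ≤ A.1)
  have h₂ : e M ≤ e B := e.monotone (inf_le_right : A.1 ⊓ B.1 ≤ B.1)
  rw [hA] at h₁
  rw [hB] at h₂
  have h : M ≤ bot := e.le_iff_le.1 ⟨h₂.1, h₁.2⟩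
  exact le_bot_iff.1 (hbot ▸ (show A.1 ⊓ B.1 ≤ bot.1 from h))

theorem factor_sup_eq_top [Finite G] {L₁ L₂ : Type*} [Lattice L₁] [Lattice L₂]
    (e : CD G ≃o L₁ × L₂) {bot top A B : CD G} (htop : top.1 = ⊤)
    (hA : e A = ((e top).1, (e bot).2)) (hB : e B = ((e bot).1, (e top).2)) :
    A.1 ⊔ B.1 = ⊤ := by
  let M : CD G := ⟨A.1 ⊔ B.1, sup_mem_CD A.2 B.2⟩
  have h₁ : e A ≤ e M := e.monotone (le_sup_left : A.1 ≤ A.1 ⊔ B.1)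
  have h₂ : e B ≤ e M := e.monotone (le_sup_right : B.1 ≤ A.1 ⊔ B.1)
  rw [hA] at h₁
  rw [hB] at h₂
  have h : top ≤ M := e.le_iff_le.1 ⟨h₁.1, h₂.2⟩
  exact top_le_iff.1 (htop ▸ (show top.1 ≤ A.1 ⊔ B.1 from h))

theorem factor_normal [Finite G] {L₁ L₂ : Type*} [Lattice L₁] [Lattice L₂]
    (e : CD G ≃o L₁ × L₂) {bot top A B : CD G} (hbot : bot.1 = ⊥) (htop : top.1 = ⊤)
    (hA : e A = ((e top).1, (e bot).2)) (hB : e B = ((e bot).1, (e top).2)) :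
    A.1.Normal := by
  have hinf := factor_inf_eq_bot e hbot hA hB
  have hsup := factor_sup_eq_top e htop hA hB
  have hconj : ∀ g ∈ B.1, A.1.map (MulAut.conj g).toMonoidHom = A.1 := by
    intro g hg
    have hBg : B.1.map (MulAut.conj g).toMonoidHom = B.1 :=
      Subgroup.mem_normalizer_iff_map_conj_eq.1 (Subgroup.le_normalizer hg)
    refine congrArg Subtype.val (eq_of_isCompl_factor e hbot htop hA hB
      (C := ⟨_, map_equiv_mem_CD A.2 (MulAut.conj g)⟩) ?_ ?_)
    · change A.1.map (MulAut.conj g).toMonoidHom ⊓ B.1 = ⊥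
      nth_rw 1 [← hBg]
      rw [← Subgroup.map_inf _ _ _ (MulAut.conj g).injective, hinf, Subgroup.map_bot]
    · change A.1.map (MulAut.conj g).toMonoidHom ⊔ B.1 = ⊤
      nth_rw 1 [← hBg]
      rw [← Subgroup.map_sup, hsup]
      exact Subgroup.map_top_of_surjective _ (MulAut.conj g).surjective
  rw [← Subgroup.normalizer_eq_top_iff, ← top_le_iff, ← hsup]
  refine sup_le Subgroup.le_normalizer fun g hg =>
    Subgroup.mem_normalizer_iff_map_conj_eq.2 (hconj g hg)

/-- The Chermak-Delgado lattice of the first direct factor is the first lattice factor. -/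
theorem nonempty_CD_factor_orderIso [Finite G] {L₁ L₂ : Type*} [Lattice L₁] [Lattice L₂]
    (e : CD G ≃o L₁ × L₂) {bot top A B : CD G} (hbot : bot.1 = ⊥) (htop : top.1 = ⊤)
    (hA : e A = ((e top).1, (e bot).2)) (hAn : A.1.Normal) (hBn : B.1.Normal)
    (hinf : A.1 ⊓ B.1 = ⊥) (hsup : A.1 ⊔ B.1 = ⊤) : Nonempty (CD A.1 ≃o L₁) := by
  have hmem := map_subtype_mem_CD_iff (hbot ▸ bot.2) hAn hBn hinf hsup
  let φ : CD A.1 → CD G := fun U => ⟨U.1.map A.1.subtype, (hmem U.1).2 U.2⟩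
  have hφ : ∀ U, (e (φ U)).2 = (e bot).2 := by
    intro U
    have h₁ : e bot ≤ e (φ U) := e.monotone (show bot.1 ≤ (φ U).1 from hbot ▸ bot_le)
    have h₂ : e (φ U) ≤ e A := e.monotone (Subgroup.map_subtype_le U.1)
    rw [hA] at h₂
    exact le_antisymm h₂.2 h₁.2
  have hle : ∀ U V, (e (φ U)).1 ≤ (e (φ V)).1 ↔ U ≤ V := by
    intro U V
    have h : e (φ U) ≤ e (φ V) ↔ (e (φ U)).1 ≤ (e (φ V)).1 := by
      rw [Prod.le_def, hφ, hφ]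
      exact and_iff_left le_rfl
    rw [← h, e.le_iff_le]
    exact Subgroup.map_subtype_le_map_subtype
  refine ⟨RelIso.ofSurjective (OrderEmbedding.ofMapLEIff (fun U => (e (φ U)).1) hle) ?_⟩
  intro a
  have hXA : (e.symm (a, (e bot).2)) ≤ A := by
    have ht : e (e.symm (a, (e top).2)) ≤ e top :=
      e.monotone (show (e.symm (a, (e top).2)).1 ≤ top.1 from htop ▸ le_top)
    rw [e.apply_symm_apply] at ht
    exact e.symm_apply_le.2 (hA ▸ ⟨ht.1, le_rfl⟩)
  have hX : ((e.symm (a, (e bot).2)).1.subgroupOf A.1).map A.1.subtype =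
      (e.symm (a, (e bot).2)).1 := Subgroup.map_subgroupOf_eq_of_le hXA
  refine ⟨⟨_, (hmem _).1 (hX.symm ▸ (e.symm (a, (e bot).2)).2)⟩, ?_⟩
  have : φ ⟨_, (hmem _).1 (hX.symm ▸ (e.symm (a, (e bot).2)).2)⟩ = e.symm (a, (e bot).2) :=
    Subtype.ext hX
  change (e (φ _)).1 = a
  rw [this, e.apply_symm_apply]

end ChermakDelgado

theorem stmt10 {G : Type} [Group G] [Fintype G] (hbot : (⊥ : Subgroup G) ∈ CD G)
    (L₁ L₂ : Type) [Lattice L₁] [Lattice L₂]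
    (e : ↥(CD G) ≃o (L₁ × L₂)) :
    ∃ H K : Subgroup G,
      H.Normal ∧ K.Normal ∧ H ⊓ K = ⊥ ∧
      (H : Set G) * (K : Set G) = Set.univ ∧
      Nonempty (↥(CD H) ≃o L₁) ∧ Nonempty (↥(CD K) ≃o L₂) := by
  let bot : CD G := ⟨⊥, hbot⟩
  let top : CD G := ⟨⊤, top_mem_CD hbot⟩
  let A : CD G := e.symm ((e top).1, (e bot).2)
  let B : CD G := e.symm ((e bot).1, (e top).2)
  let e' : CD G ≃o L₂ × L₁ := e.trans OrderIso.prodComm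
  have hA : e A = ((e top).1, (e bot).2) := e.apply_symm_apply _
  have hB : e B = ((e bot).1, (e top).2) := e.apply_symm_apply _
  have hA' : e' A = ((e' bot).1, (e' top).2) := congrArg Prod.swap hA
  have hB' : e' B = ((e' top).1, (e' bot).2) := congrArg Prod.swap hB
  have hinf := factor_inf_eq_bot e rfl hA hB
  have hsup := factor_sup_eq_top e rfl hA hB
  have hAn := factor_normal e rfl rfl hA hB
  have hBn := factor_normal e' rfl rfl hB' hA'
  refine ⟨A.1, B.1, hAn, hBn, hinf, ?_,
    nonempty_CD_factor_orderIso e rfl rfl hA hAn hBn hinf hsup,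
    nonempty_CD_factor_orderIso e' rfl rfl hB' hBn hAn (inf_comm A.1 B.1 ▸ hinf)
      (sup_comm A.1 B.1 ▸ hsup)⟩
  rw [← Subgroup.mul_normal, hsup, Subgroup.coe_top]
end
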